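/- Let p₁, p₂, p₃ be distinct real numbers with p₁³ - 3βp₁ = p₂³ - 3βp₂ = p₃³ - 3βp₃ (i.e. they are the three roots of a common cubic z³ = 3βz + c), and let k₁, k₂ > 0. Define τ(x,t) = exp(p₃x + p₃²t) + k₁ exp(p₁x + p₁²t) + k₂ exp(p₂x + p₂²t). Then u = 2(log τ)_xx satisfies the scalar Boussinesq equation u_tt - 4βu_xx + (1/3)u_xxxx + (u²)_xx = 0. -/

import Mathlib

theorem iteratedDeriv_succ_eq_of_hasDerivAt {f f' : ℝ → ℝ} (h : ∀ x, HasDerivAt f (f' x) x)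
    (n : ℕ) : iteratedDeriv (n + 1) f = iteratedDeriv n f' := by
  rw [iteratedDeriv_succ', funext fun x => (h x).deriv]

/-- If the logarithmic moments `a`, `b` satisfy the Riccati system attached to the cubic
`z ^ 3 = 3 * β * z + c`, then `2 * (b - a ^ 2)` solves the Boussinesq equation. -/
theorem boussinesq_of_riccati {β c : ℝ} {a b : ℝ → ℝ → ℝ}
    (hax : ∀ x t, HasDerivAt (fun y => a y t) (b x t - a x t ^ 2) x)
    (hbx : ∀ x t, HasDerivAt (fun y => b y t) (3 * β * a x t + c - a x t * b x t) x)
    (hat : ∀ x t, HasDerivAt (fun s => a x s) (3 * β * a x t + c - a x t * b x t) t)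
    (hbt : ∀ x t, HasDerivAt (fun s => b x s) (3 * β * b x t + c * a x t - b x t ^ 2) t)
    (x t : ℝ) :
    iteratedDeriv 2 (fun s => 2 * (b x s - a x s ^ 2)) t
      - 4 * β * iteratedDeriv 2 (fun y => 2 * (b y t - a y t ^ 2)) x
      + (1 / 3) * iteratedDeriv 4 (fun y => 2 * (b y t - a y t ^ 2)) x
      + iteratedDeriv 2 (fun y => (2 * (b y t - a y t ^ 2)) ^ 2) x = 0 := by
  have hx₁ : ∀ y, HasDerivAt (fun y => 2 * (b y t - a y t ^ 2))
      (2 * (3 * β * a y t + c - 3 * (a y t * b y t) + 2 * a y t ^ 3)) y := fun y =>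
    (((hbx y t).sub ((hax y t).fun_pow 2)).const_mul 2).congr_deriv (by push_cast; ring)
  have hx₂ : ∀ y, HasDerivAt
      (fun y => 2 * (3 * β * a y t + c - 3 * (a y t * b y t) + 2 * a y t ^ 3))
      (2 * (3 * β * b y t - 12 * β * a y t ^ 2 - 3 * b y t ^ 2 + 12 * (a y t ^ 2 * b y t)
        - 3 * c * a y t - 6 * a y t ^ 4)) y := fun y =>
    ((((((hax y t).const_mul (3 * β)).add_const c).sub
      (((hax y t).fun_mul (hbx y t)).const_mul 3)).add
      (((hax y t).fun_pow 3).const_mul 2)).const_mul 2).congr_deriv (by push_cast; ring)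
  have hx₃ : ∀ y, HasDerivAt
      (fun y => 2 * (3 * β * b y t - 12 * β * a y t ^ 2 - 3 * b y t ^ 2
        + 12 * (a y t ^ 2 * b y t) - 3 * c * a y t - 6 * a y t ^ 4))
      (2 * (30 * (a y t * b y t ^ 2) + 24 * a y t ^ 5 + 60 * β * a y t ^ 3
        + 15 * c * a y t ^ 2 + 9 * β ^ 2 * a y t + 3 * β * c
        - 60 * (a y t ^ 3 * b y t) - 45 * β * (a y t * b y t)
        - 9 * c * b y t)) y := fun y =>
    (((((((hbx y t).const_mul (3 * β)).sub (((hax y t).fun_pow 2).const_mul (12 * β))).sub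
      (((hbx y t).fun_pow 2).const_mul 3)).add
      ((((hax y t).fun_pow 2).fun_mul (hbx y t)).const_mul 12)).sub
      ((hax y t).const_mul (3 * c))).sub
      (((hax y t).fun_pow 4).const_mul 6) |>.const_mul 2).congr_deriv (by push_cast; ring)
  have hx₄ : ∀ y, HasDerivAt
      (fun y => 2 * (30 * (a y t * b y t ^ 2) + 24 * a y t ^ 5 + 60 * β * a y t ^ 3
        + 15 * c * a y t ^ 2 + 9 * β ^ 2 * a y t + 3 * β * c
        - 60 * (a y t ^ 3 * b y t) - 45 * β * (a y t * b y t)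
        - 9 * c * b y t))
      (2 * (30 * b y t ^ 3 + 360 * (a y t ^ 4 * b y t)
        + 450 * β * (a y t ^ 2 * b y t)
        + 99 * c * (a y t * b y t) + 9 * β ^ 2 * b y t
        - 270 * (a y t ^ 2 * b y t ^ 2) - 120 * a y t ^ 6
        - 360 * β * a y t ^ 4 - 90 * c * a y t ^ 3 - 144 * β ^ 2 * a y t ^ 2
        - 45 * β * b y t ^ 2 - 72 * β * c * a y t - 9 * c ^ 2)) y := fun y =>
    ((((((((((((hax y t).fun_mul ((hbx y t).fun_pow 2)).const_mul 30).add
      (((hax y t).fun_pow 5).const_mul 24)).add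
      (((hax y t).fun_pow 3).const_mul (60 * β))).add
      (((hax y t).fun_pow 2).const_mul (15 * c))).add
      ((hax y t).const_mul (9 * β ^ 2))).add
      (hasDerivAt_const _ (3 * β * c))).sub
      ((((hax y t).fun_pow 3).fun_mul (hbx y t)).const_mul 60)).sub
      (((hax y t).fun_mul (hbx y t)).const_mul (45 * β))).sub
      ((hbx y t).const_mul (9 * c))) |>.const_mul 2).congr_deriv (by push_cast; ring)
  have ht₁ : ∀ s, HasDerivAt (fun s => 2 * (b x s - a x s ^ 2))
      (2 * (2 * (a x s ^ 2 * b x s) + 3 * β * b x s - 6 * β * a x s ^ 2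
        - c * a x s - b x s ^ 2)) s := fun s =>
    (((hbt x s).sub ((hat x s).fun_pow 2)).const_mul 2).congr_deriv (by push_cast; ring)
  have ht₂ : ∀ s, HasDerivAt
      (fun s => 2 * (2 * (a x s ^ 2 * b x s) + 3 * β * b x s - 6 * β * a x s ^ 2
        - c * a x s - b x s ^ 2))
      (2 * (30 * β * (a x s ^ 2 * b x s) + 3 * c * (a x s * b x s)
        + 2 * c * a x s ^ 3 + 9 * β ^ 2 * b x s + 2 * b x s ^ 3
        - 6 * (a x s ^ 2 * b x s ^ 2) - 36 * β ^ 2 * a x s ^ 2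
        - 12 * β * c * a x s - c ^ 2 - 9 * β * b x s ^ 2)) s := fun s =>
    (((((((((hat x s).fun_pow 2).fun_mul (hbt x s)).const_mul 2).add
      ((hbt x s).const_mul (3 * β))).sub
      (((hat x s).fun_pow 2).const_mul (6 * β))).sub
      ((hat x s).const_mul c)).sub
      ((hbt x s).fun_pow 2)) |>.const_mul 2).congr_deriv (by push_cast; ring)
  have hq₁ : ∀ y, HasDerivAt (fun y => (2 * (b y t - a y t ^ 2)) ^ 2)
      (2 * (2 * (b y t - a y t ^ 2)
        * (2 * (3 * β * a y t + c - 3 * (a y t * b y t) + 2 * a y t ^ 3)))) y := fun y =>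
    ((hx₁ y).fun_pow 2).congr_deriv (by push_cast; ring)
  have hq₂ := fun y => ((hx₁ y).fun_mul (hx₂ y)).const_mul 2
  simp only [iteratedDeriv_succ_eq_of_hasDerivAt hx₁, iteratedDeriv_succ_eq_of_hasDerivAt hx₂,
    iteratedDeriv_succ_eq_of_hasDerivAt hx₃, iteratedDeriv_succ_eq_of_hasDerivAt hx₄,
    iteratedDeriv_succ_eq_of_hasDerivAt ht₁, iteratedDeriv_succ_eq_of_hasDerivAt ht₂,
    iteratedDeriv_succ_eq_of_hasDerivAt hq₁, iteratedDeriv_one, iteratedDeriv_zero]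
  rw [(hq₂ x).deriv]
  ring

/-- The `n`-th moment of a combination of exponentials: each differentiation in `x` raises the
order by one. -/
noncomputable def expMoment (p k : Fin 3 → ℝ) (n : ℕ) (x t : ℝ) : ℝ :=
  ∑ i, k i * p i ^ n * Real.exp (p i * x + p i ^ 2 * t)

theorem hasDerivAt_expMoment_left (p k : Fin 3 → ℝ) (n : ℕ) (x t : ℝ) :
    HasDerivAt (fun y => expMoment p k n y t) (expMoment p k (n + 1) x t) x := by
  unfold expMoment
  refine HasDerivAt.fun_sum fun i _ => ?_
  exact ((((((hasDerivAt_id x).const_mul (p i)).add_const (p i ^ 2 * t)).exp).const_mul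
    (k i * p i ^ n))).congr_deriv (by simp only [id]; ring)

theorem hasDerivAt_expMoment_right (p k : Fin 3 → ℝ) (n : ℕ) (x t : ℝ) :
    HasDerivAt (fun s => expMoment p k n x s) (expMoment p k (n + 2) x t) t := by
  unfold expMoment
  refine HasDerivAt.fun_sum fun i _ => ?_
  exact ((((((hasDerivAt_id t).const_mul (p i ^ 2)).const_add (p i * x)).exp).const_mul
    (k i * p i ^ n))).congr_deriv (by simp only [id]; ring)

theorem expMoment_zero_pos {p k : Fin 3 → ℝ} (hk : ∀ i, 0 < k i) (x t : ℝ) :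
    0 < expMoment p k 0 x t :=
  Finset.sum_pos (fun i _ => by have := hk i; positivity) Finset.univ_nonempty

theorem expMoment_add_three {β c : ℝ} {p : Fin 3 → ℝ} (hp : ∀ i, p i ^ 3 = 3 * β * p i + c)
    (k : Fin 3 → ℝ) (n : ℕ) (x t : ℝ) :
    expMoment p k (n + 3) x t =
      3 * β * expMoment p k (n + 1) x t + c * expMoment p k n x t := by
  simp only [expMoment, Finset.mul_sum, ← Finset.sum_add_distrib]
  refine Finset.sum_congr rfl fun i _ => ?_
  rw [pow_add, hp i]
  ring

/-- The Y-shaped (merging) soliton: `u = 2 (log τ)_xx` with a three-term τ-function built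
from the three roots of a common cubic solves the scalar Boussinesq equation. -/
theorem y_soliton_solves_boussinesq (β : ℝ) (hβ : 0 < β)
    (p₁ p₂ p₃ : ℝ) (h12 : p₁ ≠ p₂) (h13 : p₁ ≠ p₃) (h23 : p₂ ≠ p₃)
    (hc12 : p₁ ^ 3 - 3 * β * p₁ = p₂ ^ 3 - 3 * β * p₂)
    (hc23 : p₂ ^ 3 - 3 * β * p₂ = p₃ ^ 3 - 3 * β * p₃)
    (k₁ k₂ : ℝ) (hk₁ : 0 < k₁) (hk₂ : 0 < k₂)
    (τ : ℝ → ℝ → ℝ)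
    (hτ : ∀ x t, τ x t = Real.exp (p₃ * x + p₃ ^ 2 * t)
      + k₁ * Real.exp (p₁ * x + p₁ ^ 2 * t) + k₂ * Real.exp (p₂ * x + p₂ ^ 2 * t))
    (u : ℝ → ℝ → ℝ)
    (hu : ∀ x t, u x t = 2 * iteratedDeriv 2 (fun x' => Real.log (τ x' t)) x) :
    ∀ x t,
      iteratedDeriv 2 (fun t' => u x t') t
        - 4 * β * iteratedDeriv 2 (fun x' => u x' t) x
        + (1/3) * iteratedDeriv 4 (fun x' => u x' t) x
        + iteratedDeriv 2 (fun x' => (u x' t) ^ 2) x = 0 := by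
  intro x t
  set p : Fin 3 → ℝ := ![p₃, p₁, p₂] with hp_def
  set k : Fin 3 → ℝ := ![1, k₁, k₂] with hk_def
  have hp : ∀ i, p i ^ 3 = 3 * β * p i + (p₃ ^ 3 - 3 * β * p₃) := by
    intro i
    fin_cases i <;> simp [hp_def] <;> linarith
  have hk : ∀ i, 0 < k i := by
    intro i
    fin_cases i <;> simp [hk_def, hk₁, hk₂]
  have hne : ∀ x t, expMoment p k 0 x t ≠ 0 := fun x t => (expMoment_zero_pos hk x t).ne'
  have hτ' : ∀ x t, τ x t = expMoment p k 0 x t := by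
    intro x t
    simp [hτ, expMoment, Fin.sum_univ_three, hp_def, hk_def]
  have h_left (n : ℕ) (x t : ℝ) := (hasDerivAt_expMoment_left p k n x t).fun_div
    (hasDerivAt_expMoment_left p k 0 x t) (hne x t)
  have h_right (n : ℕ) (x t : ℝ) := (hasDerivAt_expMoment_right p k n x t).fun_div
    (hasDerivAt_expMoment_right p k 0 x t) (hne x t)
  have hlog (x t : ℝ) : HasDerivAt (fun y => Real.log (τ y t))
      (expMoment p k 1 x t / expMoment p k 0 x t) x := by
    simp only [hτ']
    exact (hasDerivAt_expMoment_left p k 0 x t).log (hne x t)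
  have hax (x t : ℝ) : HasDerivAt (fun y => expMoment p k 1 y t / expMoment p k 0 y t)
      (expMoment p k 2 x t / expMoment p k 0 x t
        - (expMoment p k 1 x t / expMoment p k 0 x t) ^ 2) x :=
    (h_left 1 x t).congr_deriv (by have := hne x t; norm_num; field_simp)
  have hu' : ∀ x t, u x t = 2 * (expMoment p k 2 x t / expMoment p k 0 x t
      - (expMoment p k 1 x t / expMoment p k 0 x t) ^ 2) := by
    intro x t
    rw [hu, iteratedDeriv_succ_eq_of_hasDerivAt fun y => hlog y t, iteratedDeriv_one,
      (hax x t).deriv]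
  simp only [hu']
  refine boussinesq_of_riccati (c := p₃ ^ 3 - 3 * β * p₃)
    (a := fun x t => expMoment p k 1 x t / expMoment p k 0 x t)
    (b := fun x t => expMoment p k 2 x t / expMoment p k 0 x t) hax ?_ ?_ ?_ x t
  · refine fun x t => (h_left 2 x t).congr_deriv ?_
    have := hne x t
    rw [expMoment_add_three hp k 0]
    norm_num
    field_simp
  · refine fun x t => (h_right 1 x t).congr_deriv ?_
    have := hne x t
    rw [expMoment_add_three hp k 0]
    norm_num
    field_simp
  · refine fun x t => (h_right 2 x t).congr_deriv ?_
    have := hne x t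
    rw [expMoment_add_three hp k 1]
    norm_num
    field_simp
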